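/- Let [q₀,…,q_r] ∈ A₂ with q_j < 0 for some index 0 < j < r. Then the list [q₀,…,q_{j−1}−1, 1, −(q_j+1), −q_{j+1},…,−q_r] has a well-defined continued fraction value and E([q₀,…,q_r]) = E([q₀,…,q_{j−1}−1, 1, −(q_j+1), −q_{j+1},…,−q_r]). -/

import Mathlib

/-- Continued fraction value of a list of integers (junk value `0` on `[]`,
division by zero yields junk, as usual in Lean). -/
def E : List ℤ → ℚ
  | [] => 0
  | [q] => (q : ℚ)
  | q :: l => (q : ℚ) + 1 / E l

/-- The continued fraction value of the list is well defined: the list is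
nonempty and no division by zero occurs in the evaluation of `E`. -/
def EWellDef : List ℤ → Prop
  | [] => False
  | [_] => True
  | _ :: l => EWellDef l ∧ E l ≠ 0

/-- Membership in `A₀`: `[q₀,…,q_r]` with `q_i ≠ 0` for `1 ≤ i ≤ r` and
`E([q_i,…,q_r]) ≠ 0` for `0 < i < r`. -/
def memA0 (l : List ℤ) : Prop :=
  l ≠ [] ∧ (∀ i, 0 < i → i < l.length → l.getD i 0 ≠ 0) ∧
    ∀ i, 0 < i → i + 1 < l.length → E (l.drop i) ≠ 0

/-- Membership in `A₁`: member of `A₀` with `q_i ≥ 1` for `0 < i < r` and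
`q_r > 1` when `r > 0`. -/
def memA1 (l : List ℤ) : Prop :=
  memA0 l ∧ (∀ i, 0 < i → i + 1 < l.length → 1 ≤ l.getD i 0) ∧
    (1 < l.length → 1 < l.getD (l.length - 1) 0)

/-- Membership in `A₂`: member of `A₀` with `|q_i| > 1` for `0 < i ≤ r`. -/
def memA2 (l : List ℤ) : Prop :=
  memA0 l ∧ ∀ i, 0 < i → i < l.length → 1 < |l.getD i 0|

/-- Euclidean-algorithm computation of the short continued fraction of `a/b`. -/
def scfAux (a : ℤ) (b : ℕ) : List ℤ :=
  if hb : b = 0 then []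
  else
    have h0 : 0 ≤ Int.emod a (b : ℤ) := Int.emod_nonneg a (by exact_mod_cast hb)
    have h1 : Int.emod a (b : ℤ) < (b : ℤ) :=
      Int.emod_lt_of_pos a (by exact_mod_cast Nat.pos_of_ne_zero hb)
    if hr : (Int.emod a (b : ℤ)).toNat = 0 then [Int.ediv a (b : ℤ)]
    else Int.ediv a (b : ℤ) :: scfAux (b : ℤ) (Int.emod a (b : ℤ)).toNat
  termination_by b
  decreasing_by omega

/-- `C x` is the short continued fraction representation of the rational `x`,
i.e. the unique list in `A₁` whose continued fraction value is `x`. -/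
def C (x : ℚ) : List ℤ := scfAux x.num x.den

/-- Entrywise negation of a list. -/
def negL (l : List ℤ) : List ℤ := l.map (fun q => -q)

/-- The operation `⊕` on lists. -/
def oplus (a b : List ℤ) : List ℤ :=
  match b with
  | [] => a
  | p :: ps =>
    if p = 0 then a.dropLast ++ (a.getLastD 0 + ps.headD 0) :: ps.tail
    else a ++ (p :: ps)

/-- The function `f : A₁ → A₂`. -/
def f (l : List ℤ) : List ℤ :=
  if h : (l.tail.dropLast).findIdx (fun q => q == 1) < l.tail.dropLast.length then
    let j := (l.tail.dropLast).findIdx (fun q => q == 1) + 1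
    oplus (l.take (j - 1) ++ [l.getD (j - 1) 0 + 1])
      (negL (f ((l.getD (j + 1) 0 + 1) :: l.drop (j + 2))))
  else l
  termination_by l.length
  decreasing_by
    simp only [List.length_dropLast, List.length_tail, List.length_cons,
      List.length_drop] at h ⊢
    omega

/-- The function `g : A₂ → A₁`. -/
def g (l : List ℤ) : List ℤ :=
  if h : (l.tail).findIdx (fun q => decide (q < 0)) < l.tail.length then
    let j := (l.tail).findIdx (fun q => decide (q < 0)) + 1
    oplus (l.take (j - 1) ++ [l.getD (j - 1) 0 - 1, 1])
      (g (negL ((l.getD j 0 + 1) :: l.drop (j + 1))))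
  else l
  termination_by l.length
  decreasing_by
    simp only [negL, List.length_map, List.length_cons, List.length_drop,
      List.length_tail] at h ⊢
    omega

/-- `[q₀,…,q_r]` satisfies the `(u,v)`-divisibility property: `v ∣ q_i` for even
`i` and `u ∣ q_i` for odd `i`. -/
def DivProp (u v : ℤ) (l : List ℤ) : Prop :=
  ∀ i, i < l.length → (i % 2 = 0 → v ∣ l.getD i 0) ∧ (i % 2 = 1 → u ∣ l.getD i 0)


theorem E_cons (q : ℤ) {l : List ℤ} (hl : l ≠ []) : E (q :: l) = q + 1 / E l := by
  cases l with
  | nil => exact absurd rfl hl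
  | cons => rfl

theorem eWellDef_cons (q : ℤ) {l : List ℤ} (hl : l ≠ []) :
    EWellDef (q :: l) ↔ EWellDef l ∧ E l ≠ 0 := by
  cases l with
  | nil => exact absurd rfl hl
  | cons => rfl

theorem EWellDef.ne_nil {l : List ℤ} (h : EWellDef l) : l ≠ [] := by
  rintro rfl
  exact h

theorem negL_cons (q : ℤ) (l : List ℤ) : negL (q :: l) = -q :: negL l := rfl

theorem negL_ne_nil {l : List ℤ} (hl : l ≠ []) : negL l ≠ [] := by
  simpa [negL] using hl

theorem E_negL (l : List ℤ) : E (negL l) = -E l := by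
  induction l with
  | nil => simp [negL, E]
  | cons q t ih =>
    rcases eq_or_ne t [] with rfl | ht
    · simp [negL, E]
    · rw [negL_cons, E_cons _ (negL_ne_nil ht), E_cons _ ht, ih]
      push_cast
      rw [div_neg]
      ring

theorem EWellDef.negL {l : List ℤ} (h : EWellDef l) : EWellDef (negL l) := by
  induction l with
  | nil => exact h
  | cons q t ih =>
    rcases eq_or_ne t [] with rfl | ht
    · trivial
    · rw [eWellDef_cons _ ht] at h
      rw [negL_cons, eWellDef_cons _ (negL_ne_nil ht), E_negL]
      exact ⟨ih h.1, neg_ne_zero.mpr h.2⟩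

/-- The reciprocal of a rational of absolute value greater than one lies in `(-1, 1)`. -/
theorem abs_one_div_lt_one {x : ℚ} (hx : 1 < |x|) : |1 / x| < 1 := by
  rw [abs_div, abs_one, div_lt_one (by linarith)]
  exact hx

/-- A continued fraction all of whose entries have absolute value at least two is well defined
and its value has absolute value greater than one. -/
theorem eWellDef_and_one_lt_abs_E {l : List ℤ} (hl : l ≠ []) (h : ∀ q ∈ l, 1 < |q|) :
    EWellDef l ∧ 1 < |E l| := by
  induction l with
  | nil => exact absurd rfl hl
  | cons q t ih =>
    have hq : 1 < |q| := h q (by simp)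
    rcases eq_or_ne t [] with rfl | ht
    · refine ⟨trivial, ?_⟩
      simp only [E]
      exact_mod_cast hq
    · obtain ⟨hw, hE⟩ := ih ht fun x hx => h x (by simp [hx])
      rw [eWellDef_cons _ ht, E_cons _ ht]
      refine ⟨⟨hw, abs_pos.mp (by linarith)⟩, ?_⟩
      have hq2 : (2 : ℚ) ≤ |(q : ℚ)| := by
        rw [← Int.cast_abs]
        exact_mod_cast hq
      have hinv := abs_one_div_lt_one hE
      have htri := abs_sub_abs_le_abs_add (q : ℚ) (1 / E t)
      linarith

/-- Replacing the tail of a continued fraction by one of equal value. -/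
theorem EWellDef.append_congr {s s' : List ℤ} (hs : s ≠ []) (hs' : EWellDef s')
    (hE : E s = E s') (p : List ℤ) (h : EWellDef (p ++ s)) :
    EWellDef (p ++ s') ∧ E (p ++ s) = E (p ++ s') := by
  induction p with
  | nil => exact ⟨hs', hE⟩
  | cons q p ih =>
    have hne : p ++ s ≠ [] := by simp [hs]
    have hne' : p ++ s' ≠ [] := by simp [hs'.ne_nil]
    rw [List.cons_append, eWellDef_cons _ hne] at h
    obtain ⟨hw, hv⟩ := ih h.1
    rw [List.cons_append, List.cons_append, eWellDef_cons _ hne', E_cons _ hne, E_cons _ hne', ← hv]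
    exact ⟨⟨hw, h.2⟩, rfl⟩

/-- The local transformation removing a negative entry `b` that follows `a`. -/
theorem eWellDef_and_E_eq_of_neg (a b : ℤ) {t : List ℤ} (ht : t ≠ []) (hb : b < -1)
    (h : ∀ q ∈ t, 1 < |q|) :
    EWellDef ((a - 1) :: 1 :: negL ((b + 1) :: t)) ∧
      E (a :: b :: t) = E ((a - 1) :: 1 :: negL ((b + 1) :: t)) := by
  obtain ⟨hw, hE⟩ := eWellDef_and_one_lt_abs_E ht h
  have hinv := (abs_lt.mp (abs_one_div_lt_one hE)).2
  have hE0 : E t ≠ 0 := abs_pos.mp (by linarith)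
  have hbq : (b : ℚ) ≤ -2 := by exact_mod_cast (by omega : b ≤ -2)
  obtain ⟨x, hx⟩ : ∃ x, x = E (b :: t) := ⟨_, rfl⟩
  have hxE : x = b + 1 / E t := by rw [hx, E_cons _ ht]
  have hx0 : x ≠ 0 := ne_of_lt (by linarith)
  have hx1 : x + 1 ≠ 0 := ne_of_lt (by linarith)
  have hw' : EWellDef (negL ((b + 1) :: t)) :=
    EWellDef.negL ((eWellDef_cons _ ht).mpr ⟨hw, hE0⟩)
  have hv' : E (negL ((b + 1) :: t)) = -(x + 1) := by
    rw [E_negL, E_cons _ ht, hxE]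
    push_cast
    ring
  have hv1 : E (1 :: negL ((b + 1) :: t)) = x / (x + 1) := by
    rw [E_cons _ hw'.ne_nil, hv']
    push_cast
    field_simp
    ring
  rw [eWellDef_cons _ (List.cons_ne_nil _ _), eWellDef_cons _ hw'.ne_nil,
    E_cons a (List.cons_ne_nil _ _), E_cons (a - 1) (List.cons_ne_nil _ _), hv1, hv', ← hx]
  refine ⟨⟨⟨hw', neg_ne_zero.mpr hx1⟩, div_ne_zero hx0 hx1⟩, ?_⟩
  push_cast
  field_simp
  ring

theorem memA2.one_lt_abs_of_mem_drop {l : List ℤ} (hl : memA2 l) {k : ℕ} (hk : 0 < k) :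
    ∀ q ∈ l.drop k, 1 < |q| := by
  intro q hq
  obtain ⟨i, hi, rfl⟩ := List.mem_iff_getElem.mp hq
  rw [List.length_drop] at hi
  have hlt : k + i < l.length := by omega
  have := hl.2 (k + i) (by omega) hlt
  rwa [List.getD_eq_getElem _ _ hlt, ← List.getElem_drop] at this

theorem memA2.eWellDef {l : List ℤ} (hl : memA2 l) : EWellDef l := by
  cases l with
  | nil => exact hl.1.1 rfl
  | cons q t =>
    rcases eq_or_ne t [] with rfl | ht
    · trivial
    · obtain ⟨hw, hE⟩ := eWellDef_and_one_lt_abs_E ht (hl.one_lt_abs_of_mem_drop one_pos)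
      exact (eWellDef_cons _ ht).mpr ⟨hw, abs_pos.mp (by linarith)⟩

/-- Lemma tran2: if `[q₀,…,q_r] ∈ A₂` with `q_j < 0` for some
`0 < j < r`, then `[q₀,…,q_{j−1}−1, 1, −(q_j+1), −q_{j+1},…,−q_r]` has a
well-defined continued fraction value, equal to `E([q₀,…,q_r])`. -/
theorem tran2 (l : List ℤ) (hl : memA2 l) (j : ℕ) (hj0 : 0 < j)
    (hjr : j + 1 < l.length) (hq : l.getD j 0 < 0) :
    EWellDef (l.take (j - 1) ++ [l.getD (j - 1) 0 - 1, 1] ++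
        negL ((l.getD j 0 + 1) :: l.drop (j + 1))) ∧
      E l = E (l.take (j - 1) ++ [l.getD (j - 1) 0 - 1, 1] ++
        negL ((l.getD j 0 + 1) :: l.drop (j + 1))) := by
  obtain ⟨k, rfl⟩ : ∃ k, j = k + 1 := ⟨j - 1, by omega⟩
  rw [Nat.add_sub_cancel]
  have hk : k < l.length := by omega
  have hk1 : k + 1 < l.length := by omega
  have hsplit : l.take k ++ l.getD k 0 :: l.getD (k + 1) 0 :: l.drop (k + 1 + 1) = l := by
    rw [List.getD_eq_getElem _ _ hk, List.getD_eq_getElem _ _ hk1, ← List.drop_eq_getElem_cons hk1,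
      ← List.drop_eq_getElem_cons hk, List.take_append_drop]
  have ht : l.drop (k + 1 + 1) ≠ [] := by
    rw [Ne, List.drop_eq_nil_iff]
    omega
  have hb : l.getD (k + 1) 0 < -1 := by
    have := hl.2 (k + 1) hj0 hk1
    rw [abs_of_neg hq] at this
    linarith
  obtain ⟨hw, hv⟩ := eWellDef_and_E_eq_of_neg (l.getD k 0) _ ht hb
    (hl.one_lt_abs_of_mem_drop (Nat.succ_pos _))
  have hmain := EWellDef.append_congr (List.cons_ne_nil _ _) hw hv (l.take k)
    (hsplit.symm ▸ hl.eWellDef)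
  rw [hsplit] at hmain
  simpa only [List.append_assoc, List.cons_append, List.nil_append] using hmain
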